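/- (Hyperbolicity of the hydrodynamic system.) Assume S is a finite set, ξ, η : S → ℤ, r : S×S×S×S → [0,∞) satisfies condition (A), π is a probability measure on S with π(ω) > 0 for all ω satisfying condition (C), condition (D) holds, and the functions ξ, η, 1 on S are linearly independent over ℝ. For (θ,τ) ∈ ℝ² let J(θ,τ) be the 2×2 Jacobian matrix of the map (θ,τ) ↦ (Φ(θ,τ), Ψ(θ,τ)) and let H(θ,τ) be the Hessian matrix of G at (θ,τ). Then for every (θ,τ) ∈ ℝ², H(θ,τ) is invertible and the matrix J(θ,τ)·H(θ,τ)⁻¹ is diagonalizable over ℝ: it is similar to a real diagonal matrix. (J·H⁻¹ is exactly the derivative matrix D(u,v) of the macroscopic fluxes with respect to the conserved densities (u,v) = ∇G(θ,τ), so the system of conservation laws ∂_t u + ∂_x Φ = 0, ∂_t v + ∂_x Ψ = 0 is hyperbolic.) -/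

import Mathlib

open scoped BigOperators

/-- The Gibbs free energy `G(θ,τ) = log Σ_ω e^{θξ(ω)+τη(ω)} π(ω)`. -/
noncomputable def freeEnergy {S : Type*} [Fintype S]
    (π : S → ℝ) (ξ η : S → ℤ) (p : ℝ × ℝ) : ℝ :=
  Real.log (∑ ω : S, Real.exp (p.1 * (ξ ω : ℝ) + p.2 * (η ω : ℝ)) * π ω)

/-- The single-site Gibbs measure `π_{θ,τ}(ω) = π(ω) exp(θξ(ω)+τη(ω)−G(θ,τ))`. -/
noncomputable def gibbsMeasure {S : Type*} [Fintype S]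
    (π : S → ℝ) (ξ η : S → ℤ) (θ τ : ℝ) (ω : S) : ℝ :=
  π ω * Real.exp (θ * (ξ ω : ℝ) + τ * (η ω : ℝ) - freeEnergy π ξ η (θ, τ))

/-- The macroscopic flux of the conserved quantity `g`. -/
noncomputable def macroFlux {S : Type*} [Fintype S]
    (r : S → S → S → S → ℝ) (π : S → ℝ) (ξ η g : S → ℤ) (p : ℝ × ℝ) : ℝ :=
  ∑ ω₁ : S, ∑ ω₂ : S,
    (∑ ω₁' : S, ∑ ω₂' : S, r ω₁ ω₂ ω₁' ω₂' * ((g ω₂' : ℝ) - (g ω₂ : ℝ))) *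
      gibbsMeasure π ξ η p.1 p.2 ω₁ * gibbsMeasure π ξ η p.1 p.2 ω₂

/-- The coordinate directions of `ℝ × ℝ`. -/
noncomputable def coordDir : Fin 2 → ℝ × ℝ := ![(1, 0), (0, 1)]

/-- The Hessian matrix of `G : ℝ × ℝ → ℝ` at a point. -/
noncomputable def hessianMatrix (G : ℝ × ℝ → ℝ) (p : ℝ × ℝ) :
    Matrix (Fin 2) (Fin 2) ℝ :=
  Matrix.of fun i j => fderiv ℝ (fun q => fderiv ℝ G q (coordDir j)) p (coordDir i)

/-- The Jacobian matrix of the pair `(Φ,Ψ) : ℝ × ℝ → ℝ × ℝ` at a point. -/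
noncomputable def jacobianMatrix (Φ Ψ : ℝ × ℝ → ℝ) (p : ℝ × ℝ) :
    Matrix (Fin 2) (Fin 2) ℝ :=
  Matrix.of fun i j => fderiv ℝ (![Φ, Ψ] i) p (coordDir j)

section Helpers

variable {S : Type*} [Fintype S]

theorem aux_sum_rev (f : S → S → S → S → ℝ) :
    ∑ a, ∑ b, ∑ c, ∑ d, f a b c d = ∑ a, ∑ b, ∑ c, ∑ d, f d c b a := by
  simp only [← Fintype.sum_prod_type']
  refine Fintype.sum_equiv
    ⟨fun x => (x.2.2.2, x.2.2.1, x.2.1, x.1), fun x => (x.2.2.2, x.2.2.1, x.2.1, x.1),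
      fun _ => rfl, fun _ => rfl⟩ _ _ (fun _ => rfl)

theorem aux_flux (r : S → S → S → S → ℝ) (m g : S → ℝ) (F : S → S → ℝ)
    (hm : ∀ a b c d, m a * m b * r a b c d = m d * m c * r d c b a)
    (hF : ∀ a b c d, r a b c d ≠ 0 → F a b = F d c) :
    ∑ a, ∑ b, (∑ c, ∑ d, r a b c d * (g d - g b)) * (m a * m b * F a b)
      = ∑ a, ∑ b, (∑ c, ∑ d, r a b c d) * (g a - g b) * (m a * m b * F a b) := by
  have h1 : ∑ a, ∑ b, ∑ c, ∑ d, (m a * m b * r a b c d) * F a b * g d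
      = ∑ a, ∑ b, ∑ c, ∑ d, (m a * m b * r a b c d) * F a b * g a := by
    rw [aux_sum_rev (fun a b c d => (m a * m b * r a b c d) * F a b * g a)]
    refine Finset.sum_congr rfl fun a _ => Finset.sum_congr rfl fun b _ =>
      Finset.sum_congr rfl fun c _ => Finset.sum_congr rfl fun d _ => ?_
    rw [← hm a b c d]
    by_cases h : r a b c d = 0
    · simp [h]
    · rw [hF a b c d h]
  have h2 : ∀ u : S → S → S → S → ℝ,
      ∑ a, ∑ b, (∑ c, ∑ d, r a b c d * (u a b c d - g b)) * (m a * m b * F a b)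
      = ∑ a, ∑ b, ∑ c, ∑ d, (m a * m b * r a b c d) * F a b * u a b c d
        - ∑ a, ∑ b, ∑ c, ∑ d, (m a * m b * r a b c d) * F a b * g b := by
    intro u
    simp only [Finset.sum_mul, ← Finset.sum_sub_distrib]
    refine Finset.sum_congr rfl fun a _ => Finset.sum_congr rfl fun b _ =>
      Finset.sum_congr rfl fun c _ => Finset.sum_congr rfl fun d _ => ?_
    ring
  rw [h2 (fun _ _ _ d => g d), h1, ← h2 (fun a _ _ _ => g a)]
  simp only [Finset.sum_mul]

theorem aux_antisym (R : S → S → ℝ) (m x y : S → ℝ)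
    (hD : ∀ a b c, R a b + R b c + R c a = R a c + R c b + R b a)
    (hm : ∑ a, m a = 1) (hx : ∑ a, m a * x a = 0) (hy : ∑ a, m a * y a = 0) :
    ∑ a, ∑ b, R a b * (x a * y b - x b * y a) * (m a * m b) = 0 := by
  have h1 : ∑ a, ∑ b, R a b * (x a * y b - x b * y a) * (m a * m b)
      = ∑ a, ∑ b, (R a b - R b a) * (m a * x a) * (m b * y b) := by
    have h2 : ∑ a, ∑ b, R a b * (m b * x b) * (m a * y a)
      = ∑ a, ∑ b, R b a * (m a * x a) * (m b * y b) := Finset.sum_comm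
    have h3 : ∑ a, ∑ b, R a b * (x a * y b - x b * y a) * (m a * m b)
      = ∑ a, ∑ b, R a b * (m a * x a) * (m b * y b)
        - ∑ a, ∑ b, R a b * (m b * x b) * (m a * y a) := by
      simp only [← Finset.sum_sub_distrib]
      refine Finset.sum_congr rfl fun a _ => Finset.sum_congr rfl fun b _ => ?_
      ring
    rw [h3, h2]
    simp only [← Finset.sum_sub_distrib]
    refine Finset.sum_congr rfl fun a _ => Finset.sum_congr rfl fun b _ => ?_
    ring
  set α : S → ℝ := fun a => ∑ c, m c * (R a c - R c a) with hα
  have h4 : ∀ a b, R a b - R b a = α a - α b := by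
    intro a b
    calc R a b - R b a = ∑ c, m c * (R a b - R b a) := by rw [← Finset.sum_mul, hm, one_mul]
      _ = _ := by
        rw [hα]
        simp only [← Finset.sum_sub_distrib]
        refine Finset.sum_congr rfl fun c _ => ?_
        linear_combination m c * hD a b c
  rw [h1]
  have h5 : ∑ a, ∑ b, (R a b - R b a) * (m a * x a) * (m b * y b)
      = (∑ a, α a * (m a * x a)) * (∑ b, m b * y b)
        - (∑ a, m a * x a) * (∑ b, α b * (m b * y b)) := by
    simp only [Finset.sum_mul_sum, ← Finset.sum_sub_distrib]
    refine Finset.sum_congr rfl fun a _ => Finset.sum_congr rfl fun b _ => ?_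
    rw [h4]; ring
  rw [h5, hx, hy]; simp

/-- Onsager symmetry, finite form. -/
theorem aux_onsager (r : S → S → S → S → ℝ) (m x y : S → ℝ) (u v : ℝ)
    (hm : ∀ a b c d, m a * m b * r a b c d = m d * m c * r d c b a)
    (hx : ∀ a b c d, r a b c d ≠ 0 → x a + x b = x c + x d)
    (hy : ∀ a b c d, r a b c d ≠ 0 → y a + y b = y c + y d)
    (hD : ∀ a b c, (∑ e, ∑ f, r a b e f) + (∑ e, ∑ f, r b c e f) + (∑ e, ∑ f, r c a e f)
      = (∑ e, ∑ f, r a c e f) + (∑ e, ∑ f, r c b e f) + (∑ e, ∑ f, r b a e f))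
    (hm1 : ∑ a, m a = 1) (hu : ∑ a, m a * x a = u) (hv : ∑ a, m a * y a = v) :
    ∑ a, ∑ b, (∑ c, ∑ d, r a b c d * (x d - x b)) * (m a * m b * (y a + y b - 2 * v))
    = ∑ a, ∑ b, (∑ c, ∑ d, r a b c d * (y d - y b)) * (m a * m b * (x a + x b - 2 * u)) := by
  rw [aux_flux r m x (fun a b => y a + y b - 2 * v) hm
      (fun a b c d h => by have := hy a b c d h; linarith),
    aux_flux r m y (fun a b => x a + x b - 2 * u) hm
      (fun a b c d h => by have := hx a b c d h; linarith), ← sub_eq_zero]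
  have h := aux_antisym (fun a b => ∑ c, ∑ d, r a b c d) m (fun a => x a - u) (fun a => y a - v)
    hD hm1
    (by simp only [mul_sub, Finset.sum_sub_distrib, ← Finset.sum_mul, hm1, hu]; ring)
    (by simp only [mul_sub, Finset.sum_sub_distrib, ← Finset.sum_mul, hm1, hv]; ring)
  have h' := congrArg (fun z => 2 * z) h
  simp only [mul_zero] at h'
  rw [← h', Finset.mul_sum, ← Finset.sum_sub_distrib]
  refine Finset.sum_congr rfl fun a _ => ?_
  rw [Finset.mul_sum, ← Finset.sum_sub_distrib]
  refine Finset.sum_congr rfl fun b _ => ?_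
  ring

/-- The linear form attached to a state. -/
noncomputable def auxL (ξ η : S → ℤ) (ω : S) : ℝ × ℝ →L[ℝ] ℝ :=
  (ξ ω : ℝ) • ContinuousLinearMap.fst ℝ ℝ ℝ + (η ω : ℝ) • ContinuousLinearMap.snd ℝ ℝ ℝ

theorem auxL_apply (ξ η : S → ℤ) (ω : S) (p : ℝ × ℝ) :
    auxL ξ η ω p = p.1 * ξ ω + p.2 * η ω := by
  simp [auxL]; ring

theorem aux_Z_pos [Nonempty S] (π : S → ℝ) (ξ η : S → ℤ) (hπ0 : ∀ ω, 0 < π ω) (p : ℝ × ℝ) :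
    0 < ∑ ω : S, Real.exp (p.1 * (ξ ω : ℝ) + p.2 * (η ω : ℝ)) * π ω :=
  Finset.sum_pos (fun ω _ => mul_pos (Real.exp_pos _) (hπ0 ω)) Finset.univ_nonempty

theorem aux_gibbs_eq [Nonempty S] (π : S → ℝ) (ξ η : S → ℤ) (hπ0 : ∀ ω, 0 < π ω) (p : ℝ × ℝ)
    (ω : S) : gibbsMeasure π ξ η p.1 p.2 ω =
      (∑ ω : S, Real.exp (p.1 * (ξ ω : ℝ) + p.2 * (η ω : ℝ)) * π ω)⁻¹ *
        (Real.exp (p.1 * (ξ ω : ℝ) + p.2 * (η ω : ℝ)) * π ω) := by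
  have := aux_Z_pos π ξ η hπ0 p
  simp only [gibbsMeasure, freeEnergy]
  rw [Real.exp_sub, Real.exp_log this]
  field_simp

theorem aux_gibbs_sum [Nonempty S] (π : S → ℝ) (ξ η : S → ℤ) (hπ0 : ∀ ω, 0 < π ω) (p : ℝ × ℝ) :
    ∑ ω, gibbsMeasure π ξ η p.1 p.2 ω = 1 := by
  simp only [aux_gibbs_eq π ξ η hπ0 p, ← Finset.mul_sum]
  exact inv_mul_cancel₀ (aux_Z_pos π ξ η hπ0 p).ne'

/-- The derivative of the free energy. -/
noncomputable def auxG (π : S → ℝ) (ξ η : S → ℤ) (p : ℝ × ℝ) : ℝ × ℝ →L[ℝ] ℝ :=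
  ∑ ω, gibbsMeasure π ξ η p.1 p.2 ω • auxL ξ η ω

theorem aux_hasFDeriv_G [Nonempty S] (π : S → ℝ) (ξ η : S → ℤ) (hπ0 : ∀ ω, 0 < π ω)
    (p : ℝ × ℝ) : HasFDerivAt (freeEnergy π ξ η) (auxG π ξ η p) p := by
  have h1 : ∀ ω, HasFDerivAt (fun p : ℝ × ℝ => Real.exp (p.1 * (ξ ω : ℝ) + p.2 * (η ω : ℝ)) * π ω)
      ((Real.exp (p.1 * (ξ ω : ℝ) + p.2 * (η ω : ℝ)) * π ω) • auxL ξ η ω) p := by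
    intro ω
    have := ((auxL ξ η ω).hasFDerivAt (x := p)).exp.mul_const (π ω)
    simp only [auxL_apply] at this
    rw [smul_smul, mul_comm (π ω)] at this
    exact this
  have h2 := (HasFDerivAt.fun_sum (u := Finset.univ) (fun ω _ => h1 ω)).log
    (aux_Z_pos π ξ η hπ0 p).ne'
  refine h2.congr_fderiv ?_
  rw [auxG, Finset.smul_sum]
  simp only [aux_gibbs_eq π ξ η hπ0 p, smul_smul]

theorem aux_hasFDeriv_gibbs [Nonempty S] (π : S → ℝ) (ξ η : S → ℤ) (hπ0 : ∀ ω, 0 < π ω)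
    (p : ℝ × ℝ) (ω : S) : HasFDerivAt (fun q : ℝ × ℝ => gibbsMeasure π ξ η q.1 q.2 ω)
      (gibbsMeasure π ξ η p.1 p.2 ω • (auxL ξ η ω - auxG π ξ η p)) p := by
  have := (((auxL ξ η ω).hasFDerivAt (x := p)).sub
    (aux_hasFDeriv_G π ξ η hπ0 p)).exp.const_mul (π ω)
  simp only [Pi.sub_apply, auxL_apply] at this
  rw [smul_smul] at this
  exact this

theorem aux_hessian [Nonempty S] (π : S → ℝ) (ξ η : S → ℤ) (hπ0 : ∀ ω, 0 < π ω)
    (p v w : ℝ × ℝ) :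
    fderiv ℝ (fun q => fderiv ℝ (freeEnergy π ξ η) q w) p v =
      ∑ ω, gibbsMeasure π ξ η p.1 p.2 ω * (auxL ξ η ω v - auxG π ξ η p v)
        * (auxL ξ η ω w - auxG π ξ η p w) := by
  have h0 : (fun q => fderiv ℝ (freeEnergy π ξ η) q w)
      = fun q => ∑ ω, gibbsMeasure π ξ η q.1 q.2 ω * auxL ξ η ω w := by
    funext q
    rw [(aux_hasFDeriv_G π ξ η hπ0 q).fderiv, auxG]
    simp [_root_.sum_apply]
  rw [h0, (HasFDerivAt.fun_sum (u := Finset.univ)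
    (fun ω _ => (aux_hasFDeriv_gibbs π ξ η hπ0 p ω).mul_const (auxL ξ η ω w))).fderiv]
  have h3 : ∑ ω, gibbsMeasure π ξ η p.1 p.2 ω * (auxL ξ η ω v - auxG π ξ η p v) = 0 := by
    simp only [mul_sub, Finset.sum_sub_distrib, ← Finset.sum_mul, aux_gibbs_sum π ξ η hπ0 p]
    simp [auxG, _root_.sum_apply]
  simp only [mul_sub _ (auxL ξ η _ w), Finset.sum_sub_distrib, ← Finset.sum_mul, h3]
  simp only [_root_.sum_apply, _root_.smul_apply,
    _root_.sub_apply, smul_eq_mul, zero_mul, sub_zero]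
  refine Finset.sum_congr rfl fun ω _ => by ring

theorem aux_jac [Nonempty S] (r : S → S → S → S → ℝ) (π : S → ℝ) (ξ η g : S → ℤ)
    (hπ0 : ∀ ω, 0 < π ω) (p v : ℝ × ℝ) :
    fderiv ℝ (macroFlux r π ξ η g) p v =
      ∑ a, ∑ b, (∑ c, ∑ d, r a b c d * ((g d : ℝ) - g b)) *
        (gibbsMeasure π ξ η p.1 p.2 a * gibbsMeasure π ξ η p.1 p.2 b *
          (auxL ξ η a v + auxL ξ η b v - 2 * auxG π ξ η p v)) := by
  have h := HasFDerivAt.fun_sum (u := Finset.univ) (fun a _ =>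
    HasFDerivAt.fun_sum (u := Finset.univ) (fun b _ =>
      (((aux_hasFDeriv_gibbs π ξ η hπ0 p a).const_mul
        (∑ c, ∑ d, r a b c d * ((g d : ℝ) - g b))).mul (aux_hasFDeriv_gibbs π ξ η hπ0 p b))))
  have h' : HasFDerivAt (macroFlux r π ξ η g) _ p := h
  rw [h'.fderiv]
  simp only [_root_.sum_apply, _root_.smul_apply,
    _root_.add_apply, _root_.sub_apply, smul_eq_mul]
  refine Finset.sum_congr rfl fun a _ => Finset.sum_congr rfl fun b _ => ?_
  ring

theorem aux_spec (K : Matrix (Fin 2) (Fin 2) ℝ) (hK : K.IsHermitian) :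
    ∃ (U : Matrix (Fin 2) (Fin 2) ℝ) (d : Fin 2 → ℝ),
      U * star U = 1 ∧ K = U * Matrix.diagonal d * star U := by
  refine ⟨hK.eigenvectorUnitary, hK.eigenvalues,
    Unitary.mul_star_self_of_mem hK.eigenvectorUnitary.2, ?_⟩
  have := hK.spectral_theorem
  simpa [Unitary.conjStarAlgAut_apply, Function.comp_def] using this

open scoped MatrixOrder Matrix.Norms.L2Operator in
theorem aux_diag (J H : Matrix (Fin 2) (Fin 2) ℝ) (hJ : J.IsHermitian) (hH : H.PosDef) :
    ∃ Q Λ : Matrix (Fin 2) (Fin 2) ℝ,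
      IsUnit Q.det ∧ Λ.IsDiag ∧ J * H⁻¹ = Q * Λ * Q⁻¹ := by
  obtain ⟨B, hB, rfl⟩ := CStarAlgebra.isStrictlyPositive_iff_eq_star_mul_self.mp
    hH.isStrictlyPositive
  rw [Matrix.star_eq_conjTranspose]
  have hBd : IsUnit B.det := (Matrix.isUnit_iff_isUnit_det _).1 hB
  have hBd' : IsUnit B.conjTranspose.det := by
    rw [Matrix.det_conjTranspose]; exact hBd.star
  have hK : (B⁻¹.conjTranspose * J * B⁻¹).IsHermitian :=
    Matrix.isHermitian_conjTranspose_mul_mul _ hJ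
  obtain ⟨U, d, hUU, hs⟩ := aux_spec _ hK
  have hUd : IsUnit U.det := Matrix.isUnit_det_of_right_inverse hUU
  refine ⟨B.conjTranspose * U, Matrix.diagonal d, ?_, Matrix.isDiag_diagonal _, ?_⟩
  · rw [Matrix.det_mul]; exact hBd'.mul hUd
  · rw [Matrix.mul_inv_rev, Matrix.mul_inv_rev, Matrix.inv_eq_right_inv hUU]
    calc J * (B⁻¹ * B.conjTranspose⁻¹)
        = B.conjTranspose * (B.conjTranspose⁻¹ * J * B⁻¹) * B.conjTranspose⁻¹ := by
          simp only [← Matrix.mul_assoc, Matrix.mul_nonsing_inv _ hBd', Matrix.one_mul]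
      _ = _ := by
          rw [← Matrix.conjTranspose_nonsing_inv, hs]
          simp only [Matrix.mul_assoc]

end Helpers

/-- hyperbolicity of the hydrodynamic system — the Hessian `H` of
`G` is invertible, and `J·H⁻¹` (the flux Jacobian in the conserved variables)
is similar to a real diagonal matrix. -/
theorem hydrodynamic_system_hyperbolic {S : Type*} [Fintype S]
    (ξ η : S → ℤ) (r : S → S → S → S → ℝ) (π : S → ℝ)
    (hr : ∀ ω₁ ω₂ ω₁' ω₂' : S, 0 ≤ r ω₁ ω₂ ω₁' ω₂')
    (hA : ∀ ω₁ ω₂ ω₁' ω₂' : S, 0 < r ω₁ ω₂ ω₁' ω₂' →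
      ξ ω₁ + ξ ω₂ = ξ ω₁' + ξ ω₂' ∧ η ω₁ + η ω₂ = η ω₁' + η ω₂')
    (hπ0 : ∀ ω : S, 0 < π ω) (hπ1 : ∑ ω : S, π ω = 1)
    (hC : ∀ ω₁ ω₂ ω₁' ω₂' : S,
      π ω₁ * π ω₂ * r ω₁ ω₂ ω₁' ω₂' = π ω₂' * π ω₁' * r ω₂' ω₁' ω₂ ω₁)
    (hD : ∀ ω₁ ω₂ ω₃ : S,
      (∑ ω₁' : S, ∑ ω₂' : S, r ω₁ ω₂ ω₁' ω₂')
        + (∑ ω₁' : S, ∑ ω₂' : S, r ω₂ ω₃ ω₁' ω₂')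
        + (∑ ω₁' : S, ∑ ω₂' : S, r ω₃ ω₁ ω₁' ω₂')
      = (∑ ω₁' : S, ∑ ω₂' : S, r ω₁ ω₃ ω₁' ω₂')
        + (∑ ω₁' : S, ∑ ω₂' : S, r ω₃ ω₂ ω₁' ω₂')
        + (∑ ω₁' : S, ∑ ω₂' : S, r ω₂ ω₁ ω₁' ω₂'))
    (hli : LinearIndependent ℝ
      ![fun ω : S => (ξ ω : ℝ), fun ω : S => (η ω : ℝ), fun _ : S => (1 : ℝ)]) :
    ∀ p : ℝ × ℝ,
      IsUnit (hessianMatrix (freeEnergy π ξ η) p).det ∧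
      ∃ Q Λ : Matrix (Fin 2) (Fin 2) ℝ,
        IsUnit Q.det ∧ Λ.IsDiag ∧
        jacobianMatrix (macroFlux r π ξ η ξ) (macroFlux r π ξ η η) p *
            (hessianMatrix (freeEnergy π ξ η) p)⁻¹ = Q * Λ * Q⁻¹ := by
  intro p
  have hne : Nonempty S := by
    by_contra h
    rw [not_nonempty_iff] at h
    simp at hπ1
  set m : S → ℝ := fun ω => gibbsMeasure π ξ η p.1 p.2 ω with hm
  have hm0 : ∀ ω, 0 < m ω := fun ω => mul_pos (hπ0 ω) (Real.exp_pos _)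
  have hm1 : ∑ ω, m ω = 1 := aux_gibbs_sum π ξ η hπ0 p
  have hA' : ∀ a b c d, r a b c d ≠ 0 →
      (ξ a : ℝ) + ξ b = ξ c + ξ d ∧ (η a : ℝ) + η b = η c + η d := by
    intro a b c d h
    have := hA a b c d (lt_of_le_of_ne (hr a b c d) (Ne.symm h))
    exact_mod_cast this
  have hmr : ∀ a b c d, m a * m b * r a b c d = m d * m c * r d c b a := by
    intro a b c d
    by_cases h : r a b c d = 0
    · have h2 := hC a b c d
      rw [h, mul_zero] at h2
      have h3 : r d c b a = 0 := by
        rcases mul_eq_zero.1 h2.symm with h4 | h4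
        · exact absurd h4 (mul_pos (hπ0 d) (hπ0 c)).ne'
        · exact h4
      rw [h, h3]; simp
    · obtain ⟨h1, h2⟩ := hA' a b c d h
      simp only [hm, gibbsMeasure]
      set G := freeEnergy π ξ η (p.1, p.2)
      have he : Real.exp (p.1 * ξ a + p.2 * η a - G) * Real.exp (p.1 * ξ b + p.2 * η b - G)
          = Real.exp (p.1 * ξ d + p.2 * η d - G) * Real.exp (p.1 * ξ c + p.2 * η c - G) := by
        rw [← Real.exp_add, ← Real.exp_add]
        congr 1
        linear_combination p.1 * h1 + p.2 * h2
      linear_combination (π a * π b * r a b c d) * he +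
        (Real.exp (p.1 * ξ d + p.2 * η d - G) * Real.exp (p.1 * ξ c + p.2 * η c - G)) * hC a b c d
  have hG : ∀ v, auxG π ξ η p v = ∑ ω, m ω * auxL ξ η ω v := by
    intro v; simp [auxG, _root_.sum_apply, hm]
  have hJ : (jacobianMatrix (macroFlux r π ξ η ξ) (macroFlux r π ξ η η) p).IsHermitian := by
    have key := aux_onsager r m (fun ω => (ξ ω : ℝ)) (fun ω => (η ω : ℝ))
      _ _ hmr (fun a b c d h => (hA' a b c d h).1) (fun a b c d h => (hA' a b c d h).2) hD hm1
      rfl rfl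
    have h01 : fderiv ℝ (macroFlux r π ξ η ξ) p (0, 1)
        = fderiv ℝ (macroFlux r π ξ η η) p (1, 0) := by
      rw [aux_jac r π ξ η ξ hπ0, aux_jac r π ξ η η hπ0]
      simpa [hG, auxL_apply] using key
    ext i j
    fin_cases i <;> fin_cases j <;>
      simp [jacobianMatrix, coordDir, h01]
  have hH : (hessianMatrix (freeEnergy π ξ η) p).PosDef := by
    have hent : ∀ i j, hessianMatrix (freeEnergy π ξ η) p i j =
      ∑ ω, m ω * (auxL ξ η ω (coordDir i) - auxG π ξ η p (coordDir i))
        * (auxL ξ η ω (coordDir j) - auxG π ξ η p (coordDir j)) :=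
      fun i j => aux_hessian π ξ η hπ0 p _ _
    refine Matrix.PosDef.of_dotProduct_mulVec_pos ?_ ?_
    · ext i j
      simp only [Matrix.conjTranspose_apply, hent, star_trivial]
      exact Finset.sum_congr rfl fun ω _ => by ring
    · intro x hx
      set f : S → ℝ := fun ω => ∑ i, x i * (auxL ξ η ω (coordDir i) - auxG π ξ η p (coordDir i))
        with hf
      have hq : star x ⬝ᵥ (hessianMatrix (freeEnergy π ξ η) p).mulVec x = ∑ ω, m ω * f ω ^ 2 := by
        simp only [dotProduct, Matrix.mulVec, Fin.sum_univ_two, hent, hf, Pi.star_apply,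
          star_trivial, Finset.mul_sum, Finset.sum_mul, ← Finset.sum_add_distrib]
        exact Finset.sum_congr rfl fun ω _ => by ring
      rw [hq]
      have hnn : ∀ ω ∈ Finset.univ, 0 ≤ m ω * f ω ^ 2 :=
        fun ω _ => mul_nonneg (hm0 ω).le (sq_nonneg _)
      refine lt_of_le_of_ne (Finset.sum_nonneg hnn) fun h0 => hx ?_
      have hz := (Finset.sum_eq_zero_iff_of_nonneg hnn).1 h0.symm
      have hf0 : ∀ ω, f ω = 0 := by
        intro ω
        have := hz ω (Finset.mem_univ _)
        simpa [(hm0 ω).ne'] using this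
      have hl := Fintype.linearIndependent_iff.1 hli
        ![x 0, x 1, -(x 0 * auxG π ξ η p (1, 0) + x 1 * auxG π ξ η p (0, 1))] (by
          funext ω
          have := hf0 ω
          simp only [hf, Fin.sum_univ_two, coordDir, auxL_apply] at this
          simp [Fin.sum_univ_three] at this ⊢
          linarith)
      ext i
      fin_cases i
      · simpa using hl 0
      · simpa using hl 1
  exact ⟨hH.det_pos.ne'.isUnit, aux_diag _ _ hJ hH⟩
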